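/- arXiv:2405.20494 — 4 statements merged into one kernel-verified Lean document; each statement's English description precedes it below -/
import Mathlib

section
/- Let d ≥ 1, let Σ be a symmetric positive definite d×d real matrix whose eigenvalues λ₁,…,λ_d all lie in the interval [λ₀, 1] for some λ₀ > 0, let μ̂ ∈ ℝ^d with m := ‖μ̂‖₂² > 0, and let γ ∈ (0,1]. Let Z ~ N(μ̂, Σ) and Z^c ~ N(μ̂/(1+γ²), Σ + (γ²/(1+γ²)) m · I_d). Then h(Z^c) − h(Z) = (1/2) Σ_{i=1}^d log(1 + γ² m / ((1+γ²) λᵢ)), and this difference satisfies the two-sided bound (d γ²/2)·log(1 + m/2) ≤ h(Z^c) − h(Z) ≤ d γ² m / (2 λ₀); in particular it is of order Θ(γ² d). -/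
open MeasureTheory Matrix Real Set

/-- The squared Euclidean norm `‖x‖₂²` on `ℝ^d`. -/
noncomputable def sqNorm {d : ℕ} (x : Fin d → ℝ) : ℝ := ∑ i, x i ^ 2

/-- The Lebesgue density of the Gaussian `N(m, S)` on `ℝ^d`
(for `S` positive definite). -/
noncomputable def gaussianPdf {d : ℕ} (m : Fin d → ℝ) (S : Matrix (Fin d) (Fin d) ℝ)
    (x : Fin d → ℝ) : ℝ :=
  (2 * π) ^ (-(d : ℝ) / 2) * S.det ^ (-(1 : ℝ) / 2) *
    Real.exp (-(1 / 2) * ((x - m) ⬝ᵥ (S⁻¹ *ᵥ (x - m))))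

/-- The multivariate Gaussian measure `N(m, S)` on `ℝ^d`, defined through its
Lebesgue density. -/
noncomputable def multivariateGaussian {d : ℕ} (m : Fin d → ℝ)
    (S : Matrix (Fin d) (Fin d) ℝ) : Measure (Fin d → ℝ) :=
  volume.withDensity fun x => ENNReal.ofReal (gaussianPdf m S x)

/-- Differential entropy `h(ν) = −∫ p log p` of a measure `ν` on `ℝ^d` with
Lebesgue density `p = dν/dx`. -/
noncomputable def diffEntropy {d : ℕ} (ν : Measure (Fin d → ℝ)) : ℝ :=
  - ∫ x, (ν.rnDeriv volume x).toReal * Real.log (ν.rnDeriv volume x).toReal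

theorem gaussianPdf_pos {d : ℕ} (m : Fin d → ℝ) {S : Matrix (Fin d) (Fin d) ℝ} (hS : 0 < S.det)
    (x : Fin d → ℝ) : 0 < gaussianPdf m S x := by
  unfold gaussianPdf
  positivity

theorem continuous_gaussianPdf {d : ℕ} (m : Fin d → ℝ) (S : Matrix (Fin d) (Fin d) ℝ) :
    Continuous (gaussianPdf m S) := by
  unfold gaussianPdf
  simp only [dotProduct, mulVec]
  fun_prop

/-- The differential entropy of a Gaussian as an integral against its explicit density. -/
theorem diffEntropy_multivariateGaussian {d : ℕ} (m : Fin d → ℝ)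
    {S : Matrix (Fin d) (Fin d) ℝ} (hS : 0 < S.det) :
    diffEntropy (multivariateGaussian m S)
      = -∫ x, gaussianPdf m S x * Real.log (gaussianPdf m S x) := by
  have hmeas : Measurable fun x => ENNReal.ofReal (gaussianPdf m S x) :=
    (continuous_gaussianPdf m S).measurable.ennreal_ofReal
  unfold diffEntropy multivariateGaussian
  congr 1
  refine integral_congr_ae ?_
  filter_upwards [Measure.rnDeriv_withDensity volume hmeas] with x hx
  rw [hx, ENNReal.toReal_ofReal (gaussianPdf_pos m hS x).le]

theorem gaussianPdf_zero_one {d : ℕ} (x : Fin d → ℝ) :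
    gaussianPdf 0 1 x = (2 * π) ^ (-(d : ℝ) / 2) * Real.exp (-(1 / 2) * (x ⬝ᵥ x)) := by
  simp [gaussianPdf]

theorem exp_mul_dotProduct_self {d : ℕ} (b : ℝ) (x : Fin d → ℝ) :
    Real.exp (-b * (x ⬝ᵥ x)) = ∏ i, Real.exp (-b * x i ^ 2) := by
  rw [← Real.exp_sum, ← Finset.mul_sum]
  simp [dotProduct, sq]

theorem integrable_exp_mul_dotProduct_self {d : ℕ} {b : ℝ} (hb : 0 < b) :
    Integrable fun x : Fin d → ℝ => Real.exp (-b * (x ⬝ᵥ x)) := by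
  simp_rw [exp_mul_dotProduct_self]
  exact Integrable.fintype_prod fun _ => integrable_exp_neg_mul_sq hb

theorem integrable_gaussianPdf_zero_one {d : ℕ} :
    Integrable (gaussianPdf (0 : Fin d → ℝ) 1) := by
  simp_rw [funext gaussianPdf_zero_one]
  exact (integrable_exp_mul_dotProduct_self (by norm_num)).const_mul _

theorem integral_gaussianPdf_zero_one {d : ℕ} :
    ∫ x, gaussianPdf (0 : Fin d → ℝ) 1 x = 1 := by
  simp_rw [gaussianPdf_zero_one, exp_mul_dotProduct_self]
  rw [integral_const_mul, integral_fintype_prod_volume_eq_pow (ι := Fin d)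
      fun t : ℝ => Real.exp (-(1 / 2) * t ^ 2), integral_gaussian,
    show π / (1 / 2) = 2 * π by ring, Fintype.card_fin, Real.sqrt_eq_rpow, ← Real.rpow_natCast,
    ← Real.rpow_mul (by positivity), ← Real.rpow_add (by positivity)]
  ring_nf
  simp

theorem integrable_gaussianPdf_zero_one_mul_log {d : ℕ} :
    Integrable fun x => gaussianPdf (0 : Fin d → ℝ) 1 x *
      Real.log (gaussianPdf (0 : Fin d → ℝ) 1 x) := by
  set c : ℝ := (2 * π) ^ (-(d : ℝ) / 2) with hc
  have hc0 : 0 < c := by positivity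
  have hquad : Integrable fun x : Fin d → ℝ =>
      Real.exp (-(1 / 2) * (x ⬝ᵥ x)) * (x ⬝ᵥ x) := by
    refine ((integrable_exp_mul_dotProduct_self (d := d)
      (show (0 : ℝ) < 1 / 4 by norm_num)).const_mul 4).mono' ?_ (.of_forall fun x => ?_)
    · simp only [dotProduct]
      exact Continuous.aestronglyMeasurable (by fun_prop)
    · have h0 : 0 ≤ x ⬝ᵥ x := Finset.sum_nonneg fun i _ => mul_self_nonneg (x i)
      have h1 := Real.add_one_le_exp (1 / 4 * (x ⬝ᵥ x))
      rw [Real.norm_of_nonneg (by positivity),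
        show -(1 / 4) * (x ⬝ᵥ x) = -(1 / 2) * (x ⬝ᵥ x) + 1 / 4 * (x ⬝ᵥ x) by ring, Real.exp_add]
      nlinarith [Real.exp_pos (-(1 / 2) * (x ⬝ᵥ x))]
  refine ((integrable_gaussianPdf_zero_one (d := d)).mul_const (Real.log c)).add
    (hquad.const_mul (-(1 / 2) * c)) |>.congr (.of_forall fun x => ?_)
  simp only [Pi.add_apply, gaussianPdf_zero_one, ← hc]
  rw [Real.log_mul hc0.ne' (Real.exp_pos _).ne', Real.log_exp]
  ring

theorem gaussianPdf_mul_transpose_apply_add {d : ℕ} (m : Fin d → ℝ)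
    {A : Matrix (Fin d) (Fin d) ℝ} (hA : A.det ≠ 0) (z : Fin d → ℝ) :
    gaussianPdf m (A * Aᵀ) (A *ᵥ z + m) = |A.det|⁻¹ * gaussianPdf 0 1 z := by
  have hdet : (A * Aᵀ).det ^ (-(1 : ℝ) / 2) = |A.det|⁻¹ := by
    rw [det_mul, det_transpose, ← abs_mul_abs_self, ← sq, ← Real.rpow_natCast,
      ← Real.rpow_mul (abs_nonneg _)]
    norm_num [Real.rpow_neg_one]
  have hquad : (A *ᵥ z) ⬝ᵥ ((A * Aᵀ)⁻¹ *ᵥ (A *ᵥ z)) = z ⬝ᵥ z := by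
    have hu : IsUnit A.det := hA.isUnit
    have hut : IsUnit Aᵀ.det := by rwa [det_transpose]
    rw [Matrix.mul_inv_rev, mulVec_mulVec, Matrix.mul_assoc, nonsing_inv_mul A hu,
      Matrix.mul_one, dotProduct_comm, dotProduct_mulVec, ← mulVec_transpose, mulVec_mulVec,
      mul_nonsing_inv _ hut, one_mulVec]
  rw [gaussianPdf_zero_one, gaussianPdf, add_sub_cancel_right, hquad, hdet]
  ring

/-- The differential entropy of `N(m, A Aᵀ)` exceeds that of the standard Gaussian by
`log |det A|`. -/
theorem diffEntropy_multivariateGaussian_mul_transpose {d : ℕ} (m : Fin d → ℝ)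
    {A : Matrix (Fin d) (Fin d) ℝ} (hA : A.det ≠ 0) :
    diffEntropy (multivariateGaussian m (A * Aᵀ))
      = diffEntropy (multivariateGaussian (0 : Fin d → ℝ) 1) + Real.log |A.det| := by
  have hpos : 0 < (A * Aᵀ).det := by
    rw [det_mul, det_transpose]
    exact mul_self_pos.mpr hA
  have habs : 0 < |A.det| := abs_pos.mpr hA
  rw [diffEntropy_multivariateGaussian m hpos, diffEntropy_multivariateGaussian 0 (by simp)]
  set f : (Fin d → ℝ) → ℝ := fun x =>
    gaussianPdf m (A * Aᵀ) x * Real.log (gaussianPdf m (A * Aᵀ) x)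
  set g : (Fin d → ℝ) → ℝ := gaussianPdf 0 1 with hg
  have hf : Measurable f :=
    (continuous_gaussianPdf _ _).measurable.mul (continuous_gaussianPdf _ _).measurable.log
  have hchange : ∫ z, f (A *ᵥ z + m) = |A.det|⁻¹ * ∫ x, f x := by
    have hmap := integral_map (μ := volume) (φ := Matrix.toLin' A) (f := fun x => f (x + m))
      (Matrix.toLin' A).continuous_of_finiteDimensional.aemeasurable
      (hf.comp (measurable_id.add_const m)).aestronglyMeasurable
    rw [Real.map_matrix_volume_pi_eq_smul_volume_pi hA, integral_smul_measure,
      integral_add_right_eq_self, ENNReal.toReal_ofReal (abs_nonneg _), abs_inv,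
      smul_eq_mul] at hmap
    simpa using hmap.symm
  have hlog : ∫ z, f (A *ᵥ z + m)
      = |A.det|⁻¹ * ((∫ z, g z * Real.log (g z)) - Real.log |A.det|) := by
    have hpt : ∀ z, f (A *ᵥ z + m)
        = |A.det|⁻¹ * (g z * Real.log (g z) - g z * Real.log |A.det|) := fun z => by
      simp only [f]
      rw [gaussianPdf_mul_transpose_apply_add m hA, Real.log_mul (inv_pos.mpr habs).ne'
        (gaussianPdf_pos 0 (by simp) z).ne', Real.log_inv]
      ring
    simp_rw [hpt]
    rw [integral_const_mul, integral_sub integrable_gaussianPdf_zero_one_mul_log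
      (integrable_gaussianPdf_zero_one.mul_const _), integral_mul_const,
      integral_gaussianPdf_zero_one, one_mul]
  have := mul_left_cancel₀ (inv_pos.mpr habs).ne' (hchange.symm.trans hlog)
  rw [this]
  ring

theorem diffEntropy_multivariateGaussian_of_orthogonal {d : ℕ} (m : Fin d → ℝ)
    {U : Matrix (Fin d) (Fin d) ℝ} (hU : U * Uᵀ = 1) {lam : Fin d → ℝ} (hlam : ∀ i, 0 < lam i) :
    diffEntropy (multivariateGaussian m (U * Matrix.diagonal lam * Uᵀ))
      = diffEntropy (multivariateGaussian (0 : Fin d → ℝ) 1)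
        + (1 / 2) * ∑ i, Real.log (lam i) := by
  set A := U * Matrix.diagonal fun i => √(lam i)
  have hAA : U * Matrix.diagonal lam * Uᵀ = A * Aᵀ := by
    have hsq : Matrix.diagonal lam
        = Matrix.diagonal (fun i => √(lam i)) * Matrix.diagonal (fun i => √(lam i)) := by
      rw [diagonal_mul_diagonal]
      simp [fun i => Real.mul_self_sqrt (hlam i).le]
    simp only [A, transpose_mul, diagonal_transpose, hsq, Matrix.mul_assoc]
  have hUdet : |U.det| = 1 := by
    have h := congrArg Matrix.det hU
    rw [det_mul, det_transpose, det_one, ← abs_mul_abs_self] at h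
    nlinarith [abs_nonneg U.det]
  have hAdet : |A.det| = ∏ i, √(lam i) := by
    rw [det_mul, abs_mul, hUdet, one_mul, det_diagonal,
      abs_of_nonneg (Finset.prod_nonneg fun i _ => Real.sqrt_nonneg _)]
  have hsqrt : ∀ i, √(lam i) ≠ 0 := fun i => (Real.sqrt_pos.mpr (hlam i)).ne'
  have hA : A.det ≠ 0 := by
    rw [← abs_ne_zero, hAdet]
    exact Finset.prod_ne_zero_iff.mpr fun i _ => hsqrt i
  rw [hAA, diffEntropy_multivariateGaussian_mul_transpose m hA, hAdet,
    Real.log_prod fun i _ => hsqrt i, Finset.mul_sum]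
  congr 1
  refine Finset.sum_congr rfl fun i _ => ?_
  rw [Real.log_sqrt (hlam i).le]
  ring

/-- Bernoulli's inequality in logarithmic form. -/
theorem mul_log_one_add_le {t x : ℝ} (ht0 : 0 ≤ t) (ht1 : t ≤ 1) (hx : 0 ≤ x) :
    t * Real.log (1 + x) ≤ Real.log (1 + t * x) := by
  have hx1 : 0 < 1 + x := by linarith
  rw [← Real.log_rpow hx1]
  exact Real.log_le_log (Real.rpow_pos_of_pos hx1 t)
    (rpow_one_add_le_one_add_mul_self (by linarith) ht0 ht1)

/-- Let `Σ` be symmetric positive definite with all eigenvalues in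
`[λ₀, 1]`, `μ̂ ≠ 0`, `γ ∈ (0,1]`, and let `Z ∼ N(μ̂, Σ)`,
`Z^c ∼ N(μ̂/(1+γ²), Σ + (γ²/(1+γ²))‖μ̂‖₂² I)`.  Then
`h(Z^c) − h(Z) = ½ ∑ᵢ log(1 + γ²‖μ̂‖₂²/((1+γ²)λᵢ))`, which moreover lies between
`(dγ²/2) log(1 + ‖μ̂‖₂²/2)` and `dγ²‖μ̂‖₂²/(2λ₀)` — hence is of order `Θ(γ²d)`. -/
theorem stmt_0 (d : ℕ) (hd : 1 ≤ d) (S : Matrix (Fin d) (Fin d) ℝ) (hS : S.PosDef)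
    (U : Matrix (Fin d) (Fin d) ℝ) (lam : Fin d → ℝ) (hU : U * Uᵀ = 1)
    (hdec : S = U * Matrix.diagonal lam * Uᵀ)
    (lam0 : ℝ) (hlam0 : 0 < lam0) (hlam : ∀ i, lam i ∈ Icc lam0 1)
    (μhat : Fin d → ℝ) (hm : 0 < sqNorm μhat) (γ : ℝ) (hγ : γ ∈ Ioc (0 : ℝ) 1) :
    diffEntropy (multivariateGaussian ((1 + γ ^ 2)⁻¹ • μhat)
        (S + (γ ^ 2 / (1 + γ ^ 2) * sqNorm μhat) • (1 : Matrix (Fin d) (Fin d) ℝ)))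
        - diffEntropy (multivariateGaussian μhat S)
      = (1 / 2) * ∑ i, Real.log (1 + γ ^ 2 * sqNorm μhat / ((1 + γ ^ 2) * lam i)) ∧
    ((d : ℝ) * γ ^ 2 / 2) * Real.log (1 + sqNorm μhat / 2) ≤
      diffEntropy (multivariateGaussian ((1 + γ ^ 2)⁻¹ • μhat)
        (S + (γ ^ 2 / (1 + γ ^ 2) * sqNorm μhat) • (1 : Matrix (Fin d) (Fin d) ℝ)))
        - diffEntropy (multivariateGaussian μhat S) ∧
    diffEntropy (multivariateGaussian ((1 + γ ^ 2)⁻¹ • μhat)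
        (S + (γ ^ 2 / (1 + γ ^ 2) * sqNorm μhat) • (1 : Matrix (Fin d) (Fin d) ℝ)))
        - diffEntropy (multivariateGaussian μhat S)
      ≤ (d : ℝ) * γ ^ 2 * sqNorm μhat / (2 * lam0) := by
  have hpos : ∀ i, 0 < lam i := fun i => hlam0.trans_le (hlam i).1
  have hγ2 : 0 < γ ^ 2 := pow_pos hγ.1 2
  have hγ2' : γ ^ 2 ≤ 1 := pow_le_one₀ hγ.1.le hγ.2
  set M := sqNorm μhat
  set s := γ ^ 2 / (1 + γ ^ 2) * M with hs
  have hs0 : 0 < s := by positivity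
  have hshift : S + s • (1 : Matrix (Fin d) (Fin d) ℝ)
      = U * Matrix.diagonal (fun i => lam i + s) * Uᵀ := by
    rw [← diagonal_add, Matrix.mul_add, Matrix.add_mul, ← hdec, ← smul_one_eq_diagonal,
      Matrix.mul_smul, Matrix.mul_one, Matrix.smul_mul, hU]
  have hfrac : ∀ i, γ ^ 2 * M / ((1 + γ ^ 2) * lam i) = s / lam i := fun i => by
    rw [hs]
    field_simp
  have heq : diffEntropy (multivariateGaussian ((1 + γ ^ 2)⁻¹ • μhat) (S + s • 1))
        - diffEntropy (multivariateGaussian μhat S)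
      = (1 / 2) * ∑ i, Real.log (1 + γ ^ 2 * M / ((1 + γ ^ 2) * lam i)) := by
    rw [hshift, hdec, diffEntropy_multivariateGaussian_of_orthogonal _ hU fun i =>
      add_pos (hpos i) hs0, diffEntropy_multivariateGaussian_of_orthogonal _ hU hpos,
      add_sub_add_left_eq_sub, ← mul_sub, ← Finset.sum_sub_distrib]
    congr 1
    refine Finset.sum_congr rfl fun i _ => ?_
    rw [hfrac, ← Real.log_div (add_pos (hpos i) hs0).ne' (hpos i).ne', add_div,
      div_self (hpos i).ne']
  refine ⟨heq, ?_, ?_⟩ <;> rw [heq]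
  · have hterm : ∀ i, γ ^ 2 * Real.log (1 + M / 2)
        ≤ Real.log (1 + γ ^ 2 * M / ((1 + γ ^ 2) * lam i)) := fun i => by
      refine (mul_log_one_add_le hγ2.le hγ2' (by positivity)).trans
        (Real.log_le_log (by positivity) ?_)
      have hden : (1 + γ ^ 2) * lam i ≤ 2 := by nlinarith [(hlam i).2, hpos i]
      have := hpos i
      rw [← mul_div_assoc]
      gcongr
    have := Finset.card_nsmul_le_sum Finset.univ _ _ fun i _ => hterm i
    rw [Finset.card_univ, Fintype.card_fin, nsmul_eq_mul] at this
    linarith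
  · have hterm : ∀ i, Real.log (1 + γ ^ 2 * M / ((1 + γ ^ 2) * lam i))
        ≤ γ ^ 2 * M / lam0 := fun i => by
      have := hpos i
      have hlog := Real.log_le_sub_one_of_pos
        (show 0 < 1 + γ ^ 2 * M / ((1 + γ ^ 2) * lam i) by positivity)
      have hden : lam0 ≤ (1 + γ ^ 2) * lam i := by nlinarith [(hlam i).1]
      have : γ ^ 2 * M / ((1 + γ ^ 2) * lam i) ≤ γ ^ 2 * M / lam0 := by gcongr
      linarith
    have := Finset.sum_le_card_nsmul Finset.univ _ _ fun i _ => hterm i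
    rw [Finset.card_univ, Fintype.card_fin, nsmul_eq_mul] at this
    calc _ ≤ 1 / 2 * ((d : ℝ) * (γ ^ 2 * M / lam0)) := by gcongr
      _ = _ := by field_simp
end

section
/- Let x₁,…,x_n ∈ ℝ^d, let r ∈ ℝ and σ > 0, and define J(W, b) := (1/n) Σ_{i=1}^n E_{ε ~ N(0, I_d)} ‖ r W x_i + σ W ε + b − ε ‖₂² for W ∈ ℝ^{d×d} and b ∈ ℝ^d. Then J has a unique global minimizer (W*, b*), given by W* = σ (σ² I_d + r² Σ̂)^{-1} and b* = − r σ (σ² I_d + r² Σ̂)^{-1} μ̂, where μ̂ is the empirical mean and Σ̂ the empirical covariance of x₁,…,x_n (note σ² I_d + r² Σ̂ is positive definite since σ > 0 and Σ̂ is positive semidefinite). -/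
open MeasureTheory ProbabilityTheory Matrix

/-- The standard Gaussian measure `N(0, I_d)` on `ℝ^d`. -/
noncomputable def stdGaussian (d : ℕ) : Measure (Fin d → ℝ) :=
  Measure.pi fun _ => gaussianReal 0 1

/-- Empirical mean `μ̂ = (1/n) ∑ᵢ xᵢ`. -/
noncomputable def empMean {d n : ℕ} (x : Fin n → Fin d → ℝ) : Fin d → ℝ :=
  (n : ℝ)⁻¹ • ∑ i, x i

/-- Empirical covariance `Σ̂ = (1/n) ∑ᵢ xᵢxᵢᵀ − μ̂μ̂ᵀ`. -/
noncomputable def empCov {d n : ℕ} (x : Fin n → Fin d → ℝ) : Matrix (Fin d) (Fin d) ℝ :=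
  (n : ℝ)⁻¹ • ∑ i, vecMulVec (x i) (x i) - vecMulVec (empMean x) (empMean x)

lemma empMean_dotProduct {d n : ℕ} (x : Fin n → Fin d → ℝ) (w : Fin d → ℝ) :
    empMean x ⬝ᵥ w = (n : ℝ)⁻¹ * ∑ i, x i ⬝ᵥ w := by
  simp [empMean, smul_dotProduct, sum_dotProduct]

lemma dotProduct_empCov_mulVec {d n : ℕ} (x : Fin n → Fin d → ℝ) (w : Fin d → ℝ) :
    w ⬝ᵥ (empCov x *ᵥ w) = (n : ℝ)⁻¹ * ∑ i, (x i ⬝ᵥ w) ^ 2 - (empMean x ⬝ᵥ w) ^ 2 := by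
  simp [empCov, sub_mulVec, smul_mulVec, sum_mulVec, vecMulVec_mulVec, sum_dotProduct,
    dotProduct_comm w, sq]

lemma dotProduct_empCov_mulVec_nonneg {d n : ℕ} (x : Fin n → Fin d → ℝ) (w : Fin d → ℝ) :
    0 ≤ w ⬝ᵥ (empCov x *ᵥ w) := by
  rw [dotProduct_empCov_mulVec, empMean_dotProduct]
  rcases Nat.eq_zero_or_pos n with rfl | hn
  · simp
  have hn' : (0 : ℝ) < n := by exact_mod_cast hn
  have h := sq_sum_le_card_mul_sum_sq (s := Finset.univ) (f := fun i => x i ⬝ᵥ w)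
  rw [Finset.card_univ, Fintype.card_fin] at h
  rw [sub_nonneg, mul_pow]
  calc (n : ℝ)⁻¹ ^ 2 * (∑ i, x i ⬝ᵥ w) ^ 2
      ≤ (n : ℝ)⁻¹ ^ 2 * (n * ∑ i, (x i ⬝ᵥ w) ^ 2) := by gcongr
    _ = (n : ℝ)⁻¹ * ∑ i, (x i ⬝ᵥ w) ^ 2 := by field_simp

lemma isSymm_empCov {d n : ℕ} (x : Fin n → Fin d → ℝ) : (empCov x).IsSymm := by
  simp [Matrix.IsSymm, empCov, transpose_sum, transpose_vecMulVec]

/-- The regularized covariance `σ²I + r²Σ̂` is positive definite. -/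
lemma posDef_smul_one_add_smul_empCov {d n : ℕ} (x : Fin n → Fin d → ℝ) (r : ℝ) {σ : ℝ}
    (hσ : 0 < σ) :
    (σ ^ 2 • (1 : Matrix (Fin d) (Fin d) ℝ) + r ^ 2 • empCov x).PosDef := by
  refine .of_dotProduct_mulVec_pos ?_ fun w hw => ?_
  · rw [IsHermitian, conjTranspose_eq_transpose_of_trivial]
    simp [(isSymm_empCov x).eq]
  · have h1 : 0 < w ⬝ᵥ w := by simpa using dotProduct_star_self_pos_iff.mpr hw
    have h2 := dotProduct_empCov_mulVec_nonneg x w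
    simp only [star_trivial, add_mulVec, smul_mulVec, one_mulVec, dotProduct_add,
      dotProduct_smul, smul_eq_mul]
    positivity

instance (d : ℕ) : IsProbabilityMeasure (_root_.stdGaussian d) := by
  unfold _root_.stdGaussian; infer_instance

lemma memLp_coord_stdGaussian (d : ℕ) (j : Fin d) :
    MemLp (fun ε : Fin d → ℝ => ε j) 2 (_root_.stdGaussian d) :=
  (memLp_id_gaussianReal' 2 (by simp)).comp_measurePreserving (measurePreserving_eval _ j)

lemma memLp_affine_stdGaussian {d : ℕ} (a : ℝ) (v : Fin d → ℝ) :
    MemLp (fun ε : Fin d → ℝ => a + v ⬝ᵥ ε) 2 (_root_.stdGaussian d) :=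
  (memLp_const a).add (memLp_finsetSum _ fun j _ => (memLp_coord_stdGaussian d j).const_mul (v j))

/-- Second moment of an affine functional of a standard Gaussian vector. -/
lemma integral_sq_affine_stdGaussian {d : ℕ} (a : ℝ) (v : Fin d → ℝ) :
    ∫ ε, (a + v ⬝ᵥ ε) ^ 2 ∂_root_.stdGaussian d = a ^ 2 + v ⬝ᵥ v := by
  have hX := memLp_affine_stdGaussian a v
  have hmean : ∫ ε, (a + v ⬝ᵥ ε) ∂_root_.stdGaussian d = a := by
    have hcoord (j : Fin d) : ∫ ε, ε j ∂_root_.stdGaussian d = 0 := by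
      have := integral_comp_eval (μ := fun _ : Fin d => gaussianReal 0 1) (i := j)
        (f := fun y : ℝ => y) (by fun_prop)
      simpa [_root_.stdGaussian] using this
    have hint (j : Fin d) : Integrable (fun ε : Fin d → ℝ => v j * ε j) (_root_.stdGaussian d) :=
      ((memLp_coord_stdGaussian d j).integrable (by norm_num)).const_mul _
    simp only [dotProduct]
    rw [integral_add (integrable_const a) (integrable_finsetSum _ fun j _ => hint j),
      integral_finsetSum _ fun j _ => hint j]
    simp [integral_const_mul, hcoord]
  have hvar : Var[fun ε => a + v ⬝ᵥ ε; _root_.stdGaussian d] = v ⬝ᵥ v := by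
    rw [variance_const_add (by simpa using (memLp_affine_stdGaussian 0 v).aestronglyMeasurable)]
    have hid : Var[id; gaussianReal 0 1] = 1 := by simp
    have := variance_sum_pi (μ := fun _ : Fin d => gaussianReal 0 1)
      (X := fun j y => v j * id y) fun j => (memLp_id_gaussianReal' 2 (by simp)).const_mul (v j)
    simp only [variance_const_mul, hid] at this
    convert this using 1
    · congr 1
      ext ε
      simp [dotProduct]
    · simp [dotProduct, sq]
  rw [variance_eq_sub hX, hmean] at hvar
  simp only [Pi.pow_apply] at hvar
  linarith

/-- Expected squared norm of an affine image of a standard Gaussian vector. -/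
lemma integral_sqNorm_affine_stdGaussian {d : ℕ} (a : Fin d → ℝ) (A : Matrix (Fin d) (Fin d) ℝ) :
    ∫ ε, sqNorm (a + A *ᵥ ε) ∂_root_.stdGaussian d = ∑ k, (a k ^ 2 + A k ⬝ᵥ A k) := by
  simp only [sqNorm, Pi.add_apply, mulVec]
  rw [integral_finsetSum _ fun k _ => (memLp_affine_stdGaussian (a k) (A k)).integrable_sq]
  exact Finset.sum_congr rfl fun k _ => integral_sq_affine_stdGaussian (a k) (A k)

/-- The objective as a sum over the rows of `W` of explicit quadratic forms. -/
lemma objective_eq_sum_rows {d n : ℕ} (hn : 0 < n) (x : Fin n → Fin d → ℝ) (r σ : ℝ)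
    (W : Matrix (Fin d) (Fin d) ℝ) (b : Fin d → ℝ) :
    (n : ℝ)⁻¹ * ∑ i, ∫ ε, sqNorm (r • (W *ᵥ x i) + σ • (W *ᵥ ε) + b - ε) ∂_root_.stdGaussian d =
      ∑ k, ((r * (empMean x ⬝ᵥ W k) + b k) ^ 2 +
        W k ⬝ᵥ ((σ ^ 2 • (1 : Matrix (Fin d) (Fin d) ℝ) + r ^ 2 • empCov x) *ᵥ W k)
        - 2 * σ * W k k + 1) := by
  have hn' : (n : ℝ) ≠ 0 := by exact_mod_cast hn.ne'
  have haff (i : Fin n) (ε : Fin d → ℝ) : r • (W *ᵥ x i) + σ • (W *ᵥ ε) + b - ε =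
      (r • (W *ᵥ x i) + b) + (σ • W - 1) *ᵥ ε := by
    simp only [sub_mulVec, smul_mulVec, one_mulVec]
    abel
  simp only [haff, integral_sqNorm_affine_stdGaussian]
  rw [Finset.sum_comm, Finset.mul_sum]
  refine Finset.sum_congr rfl fun k _ => ?_
  have hrow : (σ • W - 1) k ⬝ᵥ (σ • W - 1) k = σ ^ 2 * (W k ⬝ᵥ W k) - 2 * σ * W k k + 1 := by
    have : (σ • W - 1) k = σ • W k - Pi.single k 1 := by
      ext j
      simp [Matrix.one_apply, Pi.single_apply, eq_comm]
    rw [this]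
    simp only [sub_dotProduct, dotProduct_sub, smul_dotProduct, dotProduct_smul, smul_eq_mul,
      dotProduct_single, single_dotProduct, Pi.sub_apply, Pi.smul_apply, Pi.single_eq_same]
    ring
  have hsq (i : Fin n) : (r • (W *ᵥ x i) + b) k ^ 2 =
      r ^ 2 * (x i ⬝ᵥ W k) ^ 2 + 2 * r * b k * (x i ⬝ᵥ W k) + b k ^ 2 := by
    simp only [Pi.add_apply, Pi.smul_apply, mulVec, smul_eq_mul, dotProduct_comm (x i)]
    ring
  simp only [hrow, hsq, Finset.sum_add_distrib, ← Finset.mul_sum, Finset.sum_const,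
    Finset.card_univ, Fintype.card_fin, nsmul_eq_mul, add_mulVec, smul_mulVec, one_mulVec,
    dotProduct_add, dotProduct_smul, smul_eq_mul, dotProduct_empCov_mulVec, empMean_dotProduct]
  field_simp
  ring

/-- Completing the square for a symmetric matrix. -/
lemma dotProduct_mulVec_sub_eq {ι : Type*} [Fintype ι] {A : Matrix ι ι ℝ} (hA : A.IsSymm)
    {c e : ι → ℝ} (hc : A *ᵥ c = e) (w : ι → ℝ) :
    w ⬝ᵥ (A *ᵥ w) - 2 * (w ⬝ᵥ e) =
      (w - c) ⬝ᵥ (A *ᵥ (w - c)) + (c ⬝ᵥ (A *ᵥ c) - 2 * (c ⬝ᵥ e)) := by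
  have hcw : c ⬝ᵥ (A *ᵥ w) = w ⬝ᵥ e := by
    rw [dotProduct_mulVec, ← mulVec_transpose, hA.eq, hc, dotProduct_comm]
  simp only [mulVec_sub, sub_dotProduct, dotProduct_sub, hcw, hc]
  ring

/-- The objective
`J(W,b) = (1/n) ∑ᵢ E_{ε∼N(0,I_d)} ‖rWxᵢ + σWε + b − ε‖₂²`
has the unique global minimizer `W* = σ(σ²I + r²Σ̂)⁻¹`,
`b* = −rσ(σ²I + r²Σ̂)⁻¹ μ̂`. -/
theorem stmt_2 (d n : ℕ) (hn : 0 < n) (x : Fin n → Fin d → ℝ) (r σ : ℝ) (hσ : 0 < σ)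
    (J : Matrix (Fin d) (Fin d) ℝ → (Fin d → ℝ) → ℝ)
    (hJ : ∀ W b, J W b =
      (n : ℝ)⁻¹ * ∑ i, ∫ ε, sqNorm (r • (W *ᵥ x i) + σ • (W *ᵥ ε) + b - ε) ∂stdGaussian d) :
    (∀ W b,
        J (σ • (σ ^ 2 • (1 : Matrix (Fin d) (Fin d) ℝ) + r ^ 2 • empCov x)⁻¹)
          (-((r * σ) • ((σ ^ 2 • (1 : Matrix (Fin d) (Fin d) ℝ) + r ^ 2 • empCov x)⁻¹ *ᵥ empMean x)))
          ≤ J W b) ∧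
    (∀ W b,
        J W b =
          J (σ • (σ ^ 2 • (1 : Matrix (Fin d) (Fin d) ℝ) + r ^ 2 • empCov x)⁻¹)
            (-((r * σ) • ((σ ^ 2 • (1 : Matrix (Fin d) (Fin d) ℝ) + r ^ 2 • empCov x)⁻¹ *ᵥ empMean x))) →
        W = σ • (σ ^ 2 • (1 : Matrix (Fin d) (Fin d) ℝ) + r ^ 2 • empCov x)⁻¹ ∧
        b = -((r * σ) • ((σ ^ 2 • (1 : Matrix (Fin d) (Fin d) ℝ) + r ^ 2 • empCov x)⁻¹ *ᵥ empMean x))) := by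
  set A := σ ^ 2 • (1 : Matrix (Fin d) (Fin d) ℝ) + r ^ 2 • empCov x with hAdef
  have hA : A.PosDef := posDef_smul_one_add_smul_empCov x r hσ
  have hsymm : A.IsSymm :=
    (conjTranspose_eq_transpose_of_trivial A).symm.trans hA.isHermitian
  have hmul : A * A⁻¹ = 1 := mul_nonsing_inv A ((isUnit_iff_isUnit_det A).mp hA.isUnit)
  have hinv : (A⁻¹)ᵀ = A⁻¹ := by rw [transpose_nonsing_inv, hsymm.eq]
  set W₀ := σ • A⁻¹ with hW₀
  set b₀ := -((r * σ) • (A⁻¹ *ᵥ empMean x)) with hb₀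
  have hrow (k : Fin d) : A *ᵥ W₀ k = σ • Pi.single k 1 := by
    have : W₀ k = W₀ *ᵥ Pi.single k 1 := by
      ext j
      rw [mulVec_single_one, col_apply, hW₀, Matrix.smul_apply, Matrix.smul_apply, ← transpose_apply A⁻¹, hinv]
    rw [this, mulVec_mulVec, hW₀, Matrix.mul_smul, hmul, smul_mulVec, one_mulVec]
  have hbias (k : Fin d) : r * (empMean x ⬝ᵥ W₀ k) + b₀ k = 0 := by
    have : empMean x ⬝ᵥ W₀ k = σ * (A⁻¹ *ᵥ empMean x) k := by
      rw [dotProduct_comm, hW₀]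
      exact congrFun (smul_mulVec σ A⁻¹ (empMean x)) k
    rw [this, hb₀, Pi.neg_apply, Pi.smul_apply, smul_eq_mul]
    ring
  have hgap (W : Matrix (Fin d) (Fin d) ℝ) (b : Fin d → ℝ) : J W b = J W₀ b₀ +
      ∑ k, ((r * (empMean x ⬝ᵥ W k) + b k) ^ 2 + (W k - W₀ k) ⬝ᵥ (A *ᵥ (W k - W₀ k))) := by
    rw [hJ, hJ, objective_eq_sum_rows hn, objective_eq_sum_rows hn, ← Finset.sum_add_distrib]
    refine Finset.sum_congr rfl fun k _ => ?_
    have h := dotProduct_mulVec_sub_eq hsymm (hrow k) (W k)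
    simp only [dotProduct_smul, dotProduct_single, mul_one, smul_eq_mul] at h
    rw [hbias, ← hAdef]
    linarith
  have hquad (v : Fin d → ℝ) : 0 ≤ v ⬝ᵥ (A *ᵥ v) := by
    simpa using hA.posSemidef.dotProduct_mulVec_nonneg v
  have hterm (W : Matrix (Fin d) (Fin d) ℝ) (b : Fin d → ℝ) (k : Fin d) :
      0 ≤ (r * (empMean x ⬝ᵥ W k) + b k) ^ 2 + (W k - W₀ k) ⬝ᵥ (A *ᵥ (W k - W₀ k)) :=
    add_nonneg (sq_nonneg _) (hquad _)
  refine ⟨fun W b => ?_, fun W b h => ?_⟩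
  · rw [hgap W b]
    exact le_add_of_nonneg_right (Finset.sum_nonneg fun k _ => hterm W b k)
  · rw [hgap W b, add_eq_left, Finset.sum_eq_zero_iff_of_nonneg fun k _ => hterm W b k] at h
    have hzero (k : Fin d) := (add_eq_zero_iff_of_nonneg (sq_nonneg _) (hquad _)).mp
      (h k (Finset.mem_univ k))
    have hW : W = W₀ := by
      funext k
      by_contra hne
      have := hA.dotProduct_mulVec_pos (sub_ne_zero.mpr hne)
      rw [star_trivial, (hzero k).2] at this
      exact this.false
    subst hW
    refine ⟨rfl, funext fun k => ?_⟩
    have := pow_eq_zero_iff two_ne_zero |>.mp (hzero k).1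
    linarith [hbias k]
end

section
/- Fix λ > 0, T > 0, m ∈ ℝ and z₀ ∈ ℝ, and set g(t) := 1 + (λ−1) e^{2(t−T)} (which is strictly positive on [0,T]). If z : [0,T] → ℝ is differentiable and satisfies the linear ODE z'(t) = (1 − 1/g(t)) z(t) + (e^{t−T}/g(t)) m for all t ∈ [0,T], with z(0) = z₀, then z(T) = √( λ / (1 + (λ−1) e^{−2T}) ) · z₀ + ( 1 − √λ · e^{−T} / √(1 + (λ−1) e^{−2T}) ) · m. -/
/-- Fix `λ > 0`, `T > 0`, `m, z₀ ∈ ℝ` and set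
`g t = 1 + (λ−1)e^{2(t−T)}`.  If `z : [0,T] → ℝ` is differentiable and satisfies
`z'(t) = (1 − 1/g(t)) z(t) + (e^{t−T}/g(t)) m` on `[0,T]` with `z 0 = z₀`, then
`z T = √(λ/(1+(λ−1)e^{−2T})) z₀ + (1 − √λ e^{−T}/√(1+(λ−1)e^{−2T})) m`. -/
theorem stmt_8 (lam T m z₀ : ℝ) (hlam : 0 < lam) (hT : 0 < T)
    (g : ℝ → ℝ) (hg : ∀ t, g t = 1 + (lam - 1) * Real.exp (2 * (t - T)))
    (z : ℝ → ℝ)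
    (hode : ∀ t ∈ Set.Icc (0 : ℝ) T,
      HasDerivAt z ((1 - 1 / g t) * z t + (Real.exp (t - T) / g t) * m) t)
    (hz0 : z 0 = z₀) :
    z T = Real.sqrt (lam / (1 + (lam - 1) * Real.exp (-2 * T))) * z₀ +
      (1 - Real.sqrt lam * Real.exp (-T) /
        Real.sqrt (1 + (lam - 1) * Real.exp (-2 * T))) * m := by
  have g_pos : ∀ t ≤ T, 0 < g t := fun t ht => by
    have h1 : Real.exp (2 * (t - T)) ≤ 1 := Real.exp_le_one_iff.mpr (by linarith)
    have h2 := Real.exp_pos (2 * (t - T))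
    rw [hg]
    nlinarith
  have exp_deriv : ∀ t, HasDerivAt (fun t => Real.exp (t - T)) (Real.exp (t - T)) t := fun t => by
    simpa using ((hasDerivAt_id t).sub_const T).exp
  have g_deriv : ∀ t, HasDerivAt g (2 * (g t - 1)) t := fun t => by
    obtain rfl : g = fun t => 1 + (lam - 1) * Real.exp (2 * (t - T)) := funext hg
    refine (((((hasDerivAt_id t).sub_const T).const_mul 2).exp).const_mul
      (lam - 1)).const_add 1 |>.congr_deriv ?_
    simp only [id]
    ring
  have quot_deriv : ∀ t ∈ Set.Icc (0 : ℝ) T,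
      HasDerivAt (fun t => (z t - m * Real.exp (t - T)) / Real.sqrt (g t)) 0 t := fun t ht => by
    have hgt := g_pos t ht.2
    have hs := Real.sqrt_pos.mpr hgt
    have hsq := Real.sq_sqrt hgt.le
    refine (((hode t ht).sub ((exp_deriv t).const_mul m)).div
      ((g_deriv t).sqrt hgt.ne') hs.ne').congr_deriv ?_
    simp only [Pi.sub_apply]
    rw [← hsq, Real.sqrt_sq hs.le]
    field_simp
    ring
  have quot_const := constant_of_has_deriv_right_zero
    (fun t ht => (quot_deriv t ht).continuousAt.continuousWithinAt)
    (fun t ht => (quot_deriv t ⟨ht.1, ht.2.le⟩).hasDerivWithinAt) T ⟨hT.le, le_rfl⟩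
  have g_T : g T = lam := by simp [hg]
  have g_zero : g 0 = 1 + (lam - 1) * Real.exp (-2 * T) := by
    rw [hg]
    ring_nf
  have h_sqrt_zero := Real.sqrt_pos.mpr (g_pos 0 hT.le)
  have h_sqrt_lam := Real.sqrt_pos.mpr hlam
  simp only [g_T, hz0, sub_self, Real.exp_zero, zero_sub, mul_one] at quot_const
  rw [← g_zero, Real.sqrt_div hlam.le]
  field_simp at quot_const ⊢
  linarith
end

section
/- Let B be a symmetric positive definite d×d matrix with spectral decomposition B = U Λ Uᵀ, Λ = diag(λ₁,…,λ_d), λᵢ > 0, let m ∈ ℝ^d, α ∈ ℝ and T > 0. For t ∈ [0,T] set r_t := e^{t−T}, σ_t² := 1 − e^{2(t−T)}, and M_t := σ_t² I_d + r_t² B, which is positive definite. Then the unique solution z : [0,T] → ℝ^d of the ODE z'(t) = (I_d − M_t^{-1}) z(t) + α r_t M_t^{-1} m with z(0) = z₀ satisfies z(T) = U diag(a₁,…,a_d) Uᵀ z₀ + α U diag(e₁,…,e_d) Uᵀ m, where aᵢ = √( λᵢ / (1 + (λᵢ−1) e^{−2T}) ) and eᵢ = 1 − √λᵢ · e^{−T}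 / √(1 + (λᵢ−1) e^{−2T}). Consequently, if z₀ ~ N(0, I_d), then z(T) is Gaussian with mean α U diag(e₁,…,e_d) Uᵀ m and covariance U diag(a₁²,…,a_d²) Uᵀ, and as T → ∞ this mean converges to α m and this covariance converges to B. -/
open MeasureTheory ProbabilityTheory Matrix Real Filter

/-- `aᵢ = √(λᵢ / (1 + (λᵢ − 1) e^{−2T}))`. -/
noncomputable def aCoef (lam T : ℝ) : ℝ :=
  Real.sqrt (lam / (1 + (lam - 1) * Real.exp (-2 * T)))

/-- `eᵢ = 1 − √λᵢ e^{−T} / √(1 + (λᵢ − 1) e^{−2T})`. -/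
noncomputable def eCoef (lam T : ℝ) : ℝ :=
  1 - Real.sqrt lam * Real.exp (-T) / Real.sqrt (1 + (lam - 1) * Real.exp (-2 * T))

/-- The matrix `M_t = σ_t² I + r_t² B` with `r_t = e^{t−T}`, `σ_t² = 1 − e^{2(t−T)}`. -/
noncomputable def Mmat {d : ℕ} (B : Matrix (Fin d) (Fin d) ℝ) (T t : ℝ) :
    Matrix (Fin d) (Fin d) ℝ :=
  (1 - Real.exp (2 * (t - T))) • (1 : Matrix (Fin d) (Fin d) ℝ) +
    Real.exp (2 * (t - T)) • B

/-- The eigenvalue `1 + (λ − 1) e^{2(t−T)}` of `M_t` is positive for `t ≤ T`. -/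
theorem one_add_sub_one_mul_exp_pos {lam : ℝ} (hlam : 0 < lam) {s : ℝ} (hs : s ≤ 0) :
    0 < 1 + (lam - 1) * Real.exp s := by
  have h1 : Real.exp s ≤ 1 := Real.exp_le_one_iff.2 hs
  nlinarith [mul_pos hlam (Real.exp_pos s)]

/-- The scalar version of the ODE, in one eigendirection of `B`. -/
theorem scalar_ode_endpoint {lam α c T : ℝ} (hlam : 0 < lam) (hT : 0 ≤ T) {w : ℝ → ℝ}
    (hw : ∀ t ∈ Set.Icc (0 : ℝ) T, HasDerivAt w
      (w t - (1 + (lam - 1) * Real.exp (2 * (t - T)))⁻¹ * w t +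
        (α * Real.exp (t - T)) * ((1 + (lam - 1) * Real.exp (2 * (t - T)))⁻¹ * c)) t) :
    w T = aCoef lam T * w 0 + α * (eCoef lam T * c) := by
  set μ : ℝ → ℝ := fun t => 1 + (lam - 1) * Real.exp (2 * (t - T)) with hμ
  have hμpos : ∀ t ≤ T, 0 < μ t := fun t ht =>
    one_add_sub_one_mul_exp_pos hlam (by linarith)
  have hderiv : ∀ t ∈ Set.Icc (0 : ℝ) T, HasDerivAt
      (fun t => (w t - α * Real.exp (t - T) * c) / √(μ t)) 0 t := by
    intro t ht
    have hpos := hμpos t ht.2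
    have hsqrt : 0 < √(μ t) := Real.sqrt_pos.2 hpos
    have hsq : √(μ t) ^ 2 = μ t := Real.sq_sqrt hpos.le
    have hexp : HasDerivAt (fun t => Real.exp (t - T)) (Real.exp (t - T)) t := by
      simpa using ((hasDerivAt_id t).sub_const T).exp
    have hμ' : HasDerivAt μ (2 * (μ t - 1)) t := by
      have := (((((hasDerivAt_id t).sub_const T).const_mul 2).exp).const_mul (lam - 1)).const_add 1
      refine this.congr_deriv ?_
      simp only [hμ, id]
      ring
    have hnum := (hw t ht).sub ((hexp.const_mul α).mul_const c)
    refine (hnum.div (hμ'.sqrt hpos.ne') hsqrt.ne').congr_deriv ?_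
    change ((w t - (μ t)⁻¹ * w t + (α * Real.exp (t - T)) * ((μ t)⁻¹ * c) -
      α * Real.exp (t - T) * c) * √(μ t) - (w t - α * Real.exp (t - T) * c) *
        (2 * (μ t - 1) / (2 * √(μ t)))) / √(μ t) ^ 2 = 0
    generalize √(μ t) = s at *
    rw [← hsq]
    field_simp
    ring
  have hconst := constant_of_has_deriv_right_zero
    (fun t ht => (hderiv t ht).continuousAt.continuousWithinAt)
    (fun t ht => (hderiv t ⟨ht.1, ht.2.le⟩).hasDerivWithinAt) T ⟨hT, le_rfl⟩
  have hμT : μ T = lam := by simp [hμ]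
  have hμ0 : μ 0 = 1 + (lam - 1) * Real.exp (-2 * T) := by simp [hμ]
  simp only [hμT, hμ0, sub_self, Real.exp_zero, zero_sub] at hconst
  have h0 : 0 < 1 + (lam - 1) * Real.exp (-2 * T) := hμ0 ▸ hμpos 0 hT
  rw [aCoef, eCoef, Real.sqrt_div hlam.le]
  have h1 := Real.sqrt_pos.2 h0
  have h2 := Real.sqrt_pos.2 hlam
  generalize √(1 + (lam - 1) * Real.exp (-2 * T)) = q at *
  generalize √lam = l at *
  field_simp at hconst ⊢
  linarith

theorem mulVec_mulVec_conj_diagonal {d : ℕ} {U : Matrix (Fin d) (Fin d) ℝ} (hU : Uᵀ * U = 1)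
    (D : Fin d → ℝ) (x : Fin d → ℝ) (i : Fin d) :
    (Uᵀ *ᵥ ((U * Matrix.diagonal D * Uᵀ) *ᵥ x)) i = D i * (Uᵀ *ᵥ x) i := by
  rw [Matrix.mulVec_mulVec, ← Matrix.mul_assoc, ← Matrix.mul_assoc, hU, Matrix.one_mul,
    ← Matrix.mulVec_mulVec, Matrix.mulVec_diagonal]

theorem conj_diagonal_mul_conj_diagonal {d : ℕ} {U : Matrix (Fin d) (Fin d) ℝ} (hU : Uᵀ * U = 1)
    (D E : Fin d → ℝ) :
    (U * Matrix.diagonal D * Uᵀ) * (U * Matrix.diagonal E * Uᵀ) =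
      U * Matrix.diagonal (fun i => D i * E i) * Uᵀ := by
  calc _ = U * Matrix.diagonal D * (Uᵀ * U) * Matrix.diagonal E * Uᵀ := by
        simp only [Matrix.mul_assoc]
    _ = _ := by rw [hU, Matrix.mul_one, Matrix.mul_assoc U, Matrix.diagonal_mul_diagonal]

theorem Mmat_conj_diagonal {d : ℕ} {U : Matrix (Fin d) (Fin d) ℝ} (hU : U * Uᵀ = 1)
    (lam : Fin d → ℝ) (T t : ℝ) :
    Mmat (U * Matrix.diagonal lam * Uᵀ) T t =
      U * Matrix.diagonal (fun i => 1 + (lam i - 1) * Real.exp (2 * (t - T))) * Uᵀ := by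
  have h : Matrix.diagonal (fun i => 1 + (lam i - 1) * Real.exp (2 * (t - T))) =
      (1 - Real.exp (2 * (t - T))) • (1 : Matrix (Fin d) (Fin d) ℝ) +
        Real.exp (2 * (t - T)) • Matrix.diagonal lam := by
    ext i j
    by_cases hij : i = j
    · subst hij
      simp
      ring
    · simp [hij]
  rw [h, Mmat, Matrix.mul_add, Matrix.add_mul, Matrix.mul_smul, Matrix.mul_smul, Matrix.smul_mul,
    Matrix.smul_mul, Matrix.mul_one, hU]

theorem Mmat_conj_diagonal_inv {d : ℕ} {U : Matrix (Fin d) (Fin d) ℝ} (hU : U * Uᵀ = 1)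
    {lam : Fin d → ℝ} (hlam : ∀ i, 0 < lam i) {T t : ℝ} (ht : t ≤ T) :
    (Mmat (U * Matrix.diagonal lam * Uᵀ) T t)⁻¹ =
      U * Matrix.diagonal (fun i => (1 + (lam i - 1) * Real.exp (2 * (t - T)))⁻¹) * Uᵀ := by
  apply Matrix.inv_eq_right_inv
  rw [Mmat_conj_diagonal hU, conj_diagonal_mul_conj_diagonal (mul_eq_one_comm.1 hU)]
  have h : ∀ i, (1 + (lam i - 1) * Real.exp (2 * (t - T))) *
      (1 + (lam i - 1) * Real.exp (2 * (t - T)))⁻¹ = 1 := fun i =>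
    mul_inv_cancel₀ (one_add_sub_one_mul_exp_pos (hlam i) (by linarith)).ne'
  simp only [h, Matrix.diagonal_one, Matrix.mul_one, hU]

theorem stdGaussian_eq_withDensity (d : ℕ) :
    _root_.stdGaussian d =
      volume.withDensity fun x => ENNReal.ofReal (∏ i, gaussianPDFReal 0 1 (x i)) := by
  refine Measure.pi_eq fun s hs => ?_
  have hint : ∀ i, Integrable (gaussianPDFReal 0 1) (volume.restrict (s i)) := fun i =>
    (integrable_gaussianPDFReal 0 1).integrableOn
  rw [withDensity_apply _ (MeasurableSet.univ_pi hs), volume_pi, Measure.restrict_pi_pi,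
    ← ofReal_integral_eq_lintegral_ofReal (Integrable.fintype_prod hint)
      (.of_forall fun x => Finset.prod_nonneg fun i _ => gaussianPDFReal_nonneg _ _ _),
    integral_fintype_prod_eq_prod (fun _ => gaussianPDFReal 0 1),
    ENNReal.ofReal_prod_of_nonneg fun i _ => integral_nonneg (gaussianPDFReal_nonneg _ _)]
  refine Finset.prod_congr rfl fun i _ => ?_
  rw [gaussianReal_apply_eq_integral _ one_ne_zero]

theorem prod_gaussianPDFReal_eq {d : ℕ} (x : Fin d → ℝ) :
    ∏ i, gaussianPDFReal 0 1 (x i) =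
      (2 * π) ^ (-(d : ℝ) / 2) * Real.exp (-(1 / 2) * (x ⬝ᵥ x)) := by
  simp only [gaussianPDFReal, Finset.prod_mul_distrib, ← Real.exp_sum, Finset.prod_const,
    Finset.card_univ, Fintype.card_fin]
  congr 1
  · rw [NNReal.coe_one, mul_one, Real.sqrt_eq_rpow, ← Real.rpow_neg (by positivity),
      ← Real.rpow_natCast, ← Real.rpow_mul (by positivity)]
    congr 1
    ring
  · congr 1
    rw [dotProduct, Finset.mul_sum]
    refine Finset.sum_congr rfl fun i _ => ?_
    simp
    ring

theorem measurable_gaussianPdf {d : ℕ} (m : Fin d → ℝ) (S : Matrix (Fin d) (Fin d) ℝ) :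
    Measurable (gaussianPdf m S) := by
  apply Continuous.measurable
  unfold gaussianPdf
  fun_prop

/-- Affine change of variables for the Gaussian density. -/
theorem gaussianPdf_affine_mul_abs_det {d : ℕ} {A : Matrix (Fin d) (Fin d) ℝ} (hA : A.det ≠ 0)
    (v x : Fin d → ℝ) :
    |A.det| * gaussianPdf v (A * Aᵀ) (A *ᵥ x + v) = ∏ i, gaussianPDFReal 0 1 (x i) := by
  have hdet : (A * Aᵀ).det ^ (-(1 : ℝ) / 2) = |A.det|⁻¹ := by
    rw [Matrix.det_mul, Matrix.det_transpose, ← abs_mul_abs_self, ← sq, neg_div,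
      Real.rpow_neg (sq_nonneg _), ← Real.sqrt_eq_rpow, Real.sqrt_sq (abs_nonneg _)]
  have hunit : IsUnit A.det := hA.isUnit
  have hquad : (A *ᵥ x) ⬝ᵥ ((A * Aᵀ)⁻¹ *ᵥ (A *ᵥ x)) = x ⬝ᵥ x := by
    rw [Matrix.mul_inv_rev, Matrix.mulVec_mulVec, Matrix.mul_assoc, Matrix.nonsing_inv_mul _ hunit,
      Matrix.mul_one, Matrix.dotProduct_mulVec, Matrix.vecMul_mulVec,
      Matrix.mul_nonsing_inv _ (by rwa [Matrix.det_transpose])]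
    simp
  have habs : |A.det| ≠ 0 := abs_ne_zero.2 hA
  rw [prod_gaussianPDFReal_eq, gaussianPdf, add_sub_cancel_right, hdet, hquad]
  field_simp

/-- The image of `N(0, I_d)` under `x ↦ A x + v` is `N(v, A Aᵀ)`. -/
theorem map_affine_stdGaussian {d : ℕ} {A : Matrix (Fin d) (Fin d) ℝ} (hA : A.det ≠ 0)
    (v : Fin d → ℝ) :
    Measure.map (fun x => A *ᵥ x + v) (_root_.stdGaussian d) =
      _root_.multivariateGaussian v (A * Aᵀ) := by
  have hlin : Measurable (fun x => A *ᵥ x) := by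
    apply Continuous.measurable
    fun_prop
  have hmeas : Measurable (fun x => A *ᵥ x + v) := hlin.add_const v
  have hvol : Measure.map (fun x => A *ᵥ x + v) volume =
      ENNReal.ofReal |A.det⁻¹| • (volume : Measure (Fin d → ℝ)) := by
    have h := Real.map_matrix_volume_pi_eq_smul_volume_pi hA
    rw [show (fun x => A *ᵥ x + v) = (fun y => y + v) ∘ (Matrix.toLin' A) from rfl,
      ← Measure.map_map (measurable_add_const v) (by exact hlin), h, Measure.map_smul,
      map_add_right_eq_self]
  have hvol' : (volume : Measure (Fin d → ℝ)) =
      ENNReal.ofReal |A.det| • Measure.map (fun x => A *ᵥ x + v) volume := by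
    rw [hvol, smul_smul, ← ENNReal.ofReal_mul (abs_nonneg _), ← abs_mul, mul_inv_cancel₀ hA,
      abs_one, ENNReal.ofReal_one, one_smul]
  have hpdf := (measurable_gaussianPdf v (A * Aᵀ)).ennreal_ofReal
  ext s hs
  rw [Measure.map_apply hmeas hs, stdGaussian_eq_withDensity, withDensity_apply _ (hmeas hs),
    _root_.multivariateGaussian, withDensity_apply _ hs]
  conv_rhs => rw [hvol']
  rw [Measure.restrict_smul, lintegral_smul_measure, setLIntegral_map hs hpdf hmeas, smul_eq_mul,
    ← lintegral_const_mul _ (by exact hpdf.comp hmeas)]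
  refine lintegral_congr fun x => ?_
  rw [← ENNReal.ofReal_mul (abs_nonneg _), gaussianPdf_affine_mul_abs_det hA]

theorem tendsto_one_add_mul_exp_neg (a : ℝ) :
    Tendsto (fun T : ℝ => 1 + a * Real.exp (-2 * T)) atTop (nhds 1) := by
  have h : Tendsto (fun T : ℝ => Real.exp (-2 * T)) atTop (nhds 0) :=
    Real.tendsto_exp_atBot.comp (tendsto_id.const_mul_atTop_of_neg (by norm_num))
  simpa using (h.const_mul a).const_add 1

theorem tendsto_eCoef (lam : ℝ) : Tendsto (eCoef lam) atTop (nhds 1) := by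
  have h := (Real.tendsto_exp_neg_atTop_nhds_zero.const_mul √lam).div
    (tendsto_one_add_mul_exp_neg (lam - 1)).sqrt (by simp)
  simpa only [zero_div, mul_zero, sub_zero] using! h.const_sub 1

theorem tendsto_aCoef_sq {lam : ℝ} (hlam : 0 ≤ lam) :
    Tendsto (fun T => aCoef lam T ^ 2) atTop (nhds lam) := by
  have h := ((tendsto_const_nhds (x := lam)).div
    (tendsto_one_add_mul_exp_neg (lam - 1)) one_ne_zero).sqrt.pow 2
  rw [div_one, Real.sq_sqrt hlam] at h
  exact h

theorem tendsto_conj_diagonal {d : ℕ} (U : Matrix (Fin d) (Fin d) ℝ) {f : ℝ → Fin d → ℝ}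
    {D : Fin d → ℝ} (h : ∀ i, Tendsto (fun T => f T i) atTop (nhds (D i))) :
    Tendsto (fun T => U * Matrix.diagonal (f T) * Uᵀ) atTop
      (nhds (U * Matrix.diagonal D * Uᵀ)) := by
  have hc : Continuous fun D : Fin d → ℝ => U * Matrix.diagonal D * Uᵀ := by fun_prop
  exact (hc.tendsto D).comp (tendsto_pi_nhds.2 h)

/-- For `B = U diag(λ) Uᵀ` symmetric positive definite, the solution
of `z' = (I − M_t⁻¹) z + α r_t M_t⁻¹ m`, `z(0) = z₀`, satisfies
`z(T) = U diag(a) Uᵀ z₀ + α U diag(e) Uᵀ m`; consequently for `z₀ ∼ N(0, I_d)` the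
value `z(T)` is Gaussian with mean `α U diag(e) Uᵀ m` and covariance `U diag(a²) Uᵀ`,
and as `T → ∞` the mean tends to `α m` and the covariance tends to `B`. -/
theorem stmt_9 (d : ℕ) (B U : Matrix (Fin d) (Fin d) ℝ) (lam : Fin d → ℝ)
    (hB : B.PosDef) (hU : U * Uᵀ = 1) (hdec : B = U * Matrix.diagonal lam * Uᵀ)
    (hlam : ∀ i, 0 < lam i) (m : Fin d → ℝ) (α T : ℝ) (hT : 0 < T)
    (z : ℝ → Fin d → ℝ) (z₀ : Fin d → ℝ) (hz0 : z 0 = z₀)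
    (hode : ∀ t ∈ Set.Icc (0 : ℝ) T, HasDerivAt z
      (z t - (Mmat B T t)⁻¹ *ᵥ z t +
        (α * Real.exp (t - T)) • ((Mmat B T t)⁻¹ *ᵥ m)) t) :
    z T = (U * Matrix.diagonal (fun i => aCoef (lam i) T) * Uᵀ) *ᵥ z₀ +
        α • ((U * Matrix.diagonal (fun i => eCoef (lam i) T) * Uᵀ) *ᵥ m) ∧
    Measure.map
        (fun v => (U * Matrix.diagonal (fun i => aCoef (lam i) T) * Uᵀ) *ᵥ v +
          α • ((U * Matrix.diagonal (fun i => eCoef (lam i) T) * Uᵀ) *ᵥ m))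
        (stdGaussian d)
      = multivariateGaussian
          (α • ((U * Matrix.diagonal (fun i => eCoef (lam i) T) * Uᵀ) *ᵥ m))
          (U * Matrix.diagonal (fun i => aCoef (lam i) T ^ 2) * Uᵀ) ∧
    Tendsto (fun T' => α • ((U * Matrix.diagonal (fun i => eCoef (lam i) T') * Uᵀ) *ᵥ m))
      atTop (nhds (α • m)) ∧
    Tendsto (fun T' => U * Matrix.diagonal (fun i => aCoef (lam i) T' ^ 2) * Uᵀ)
      atTop (nhds B) := by
  have hU' : Uᵀ * U = 1 := mul_eq_one_comm.1 hU
  refine ⟨?_, ?_, ?_, ?_⟩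
  · have hcoord : ∀ i, (Uᵀ *ᵥ z T) i =
        aCoef (lam i) T * (Uᵀ *ᵥ z 0) i + α * (eCoef (lam i) T * (Uᵀ *ᵥ m) i) := by
      intro i
      refine scalar_ode_endpoint (w := fun t => (Uᵀ *ᵥ z t) i) (hlam i) hT.le fun t ht => ?_
      have h := hasDerivAt_pi.1 ((LinearMap.toContinuousLinearMap
        (Matrix.mulVecLin Uᵀ)).hasFDerivAt.comp_hasDerivAt t (hode t ht)) i
      rw [hdec, Mmat_conj_diagonal_inv hU hlam ht.2] at h
      refine h.congr_deriv ?_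
      simp only [LinearMap.coe_toContinuousLinearMap', Matrix.mulVecLin_apply, Matrix.mulVec_add,
        Matrix.mulVec_sub, Matrix.mulVec_smul, Pi.add_apply, Pi.sub_apply, Pi.smul_apply,
        mulVec_mulVec_conj_diagonal hU', smul_eq_mul]
    have hinj : Function.Injective (Uᵀ *ᵥ ·) :=
      Function.LeftInverse.injective (g := (U *ᵥ ·)) fun x => by
        simp only [Matrix.mulVec_mulVec, hU, Matrix.one_mulVec]
    apply hinj
    ext i
    simp only [Matrix.mulVec_add, Matrix.mulVec_smul, Pi.add_apply, Pi.smul_apply,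
      mulVec_mulVec_conj_diagonal hU', smul_eq_mul, hcoord i, hz0]
  · have hpos : ∀ i, 0 < aCoef (lam i) T := fun i => Real.sqrt_pos.2
      (div_pos (hlam i) (one_add_sub_one_mul_exp_pos (hlam i) (by linarith)))
    have hdet : (U * Matrix.diagonal (fun i => aCoef (lam i) T) * Uᵀ).det ≠ 0 := by
      have hUdet : U.det * Uᵀ.det = 1 := by rw [← Matrix.det_mul, hU, Matrix.det_one]
      rw [Matrix.det_mul, Matrix.det_mul, Matrix.det_diagonal]
      exact mul_ne_zero (mul_ne_zero (left_ne_zero_of_mul_eq_one hUdet)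
        (Finset.prod_pos fun i _ => hpos i).ne') (right_ne_zero_of_mul_eq_one hUdet)
    rw [map_affine_stdGaussian hdet]
    congr 1
    have hsymm : (U * Matrix.diagonal (fun i => aCoef (lam i) T) * Uᵀ)ᵀ =
        U * Matrix.diagonal (fun i => aCoef (lam i) T) * Uᵀ := by
      simp [Matrix.mul_assoc]
    rw [hsymm, conj_diagonal_mul_conj_diagonal hU']
    simp only [sq]
  · have h := tendsto_conj_diagonal U fun i => tendsto_eCoef (lam i)
    rw [Matrix.diagonal_one, Matrix.mul_one, hU] at h
    have hc : Continuous fun S : Matrix (Fin d) (Fin d) ℝ => α • (S *ᵥ m) := by fun_prop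
    simpa using! (hc.tendsto 1).comp h
  · rw [hdec]
    exact tendsto_conj_diagonal U fun i => tendsto_aCoef_sq (hlam i).le
end
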